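/- Let ν > −1 and let (P_n)_{n≥0} be a sequence of real polynomials with deg P_n = n which is orthonormal with respect to the weight ω⁺_ν(x) = e^(−x) ρ_ν(x) on (0,∞), i.e. ∫₀^∞ P_m(x) P_n(x) e^(−x) ρ_ν(x) dx = δ_{m,n} for all m, n. Set B_n = ∫₀^∞ x·P_n(x)² e^(−x) ρ_ν(x) dx. Then for every n ≥ 0, ∫₀^∞ P_n(x)² e^(−x) ρ_(ν+1)(x) dx = ν + 2n + 1 − B_n. -/

import Mathlib

open Real MeasureTheory

/-- The scaled Macdonald function `ρ_ν(x) = ∫₀^∞ t^(ν−1) e^(−t − x/t) dt`. -/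
noncomputable def rho (ν x : ℝ) : ℝ :=
  ∫ t in Set.Ioi (0 : ℝ), t ^ (ν - 1) * Real.exp (-t - x / t)

noncomputable def gK (ν : ℝ) (k : ℕ) (t : ℝ) : ℝ :=
  t ^ (ν + k) * ((1 + t) ^ (k + 1))⁻¹ * Real.exp (-t)

lemma gK_int (ν : ℝ) (hν : ν > -1) (k : ℕ) : IntegrableOn (gK ν k) (Set.Ioi 0) := by
  have hk : (0 : ℝ) ≤ k := Nat.cast_nonneg k
  have h := Real.GammaIntegral_convergent (s := ν + k + 1) (by linarith)
  refine Integrable.mono' h ?_ ?_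
  · unfold gK
    exact (Measurable.mul (Measurable.mul (by fun_prop) (by fun_prop)) (by fun_prop)).aestronglyMeasurable
  · filter_upwards [ae_restrict_mem measurableSet_Ioi] with t ht
    have ht : 0 < t := ht
    unfold gK
    rw [Real.norm_of_nonneg (by positivity), show ν + k + 1 - 1 = ν + k by ring]
    have h1 : ((1 + t) ^ (k + 1))⁻¹ ≤ 1 := inv_le_one_of_one_le₀ (one_le_pow₀ (by linarith))
    have h2 : 0 ≤ t ^ (ν + k) * Real.exp (-t) := by positivity
    nlinarith

lemma gK_rec (ν : ℝ) (hν : ν > -1) (k : ℕ) :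
    (ν + k + 1) * (∫ t in Set.Ioi (0 : ℝ), gK ν k t)
      - (k + 1) * (∫ t in Set.Ioi (0 : ℝ), gK ν (k + 1) t)
      - (∫ t in Set.Ioi (0 : ℝ), gK (ν + 1) k t) = 0 := by
  have hk : (0 : ℝ) ≤ k := Nat.cast_nonneg k
  have i1 := (gK_int ν hν k).const_mul (ν + k + 1)
  have i2 := (gK_int ν hν (k + 1)).const_mul (k + 1 : ℝ)
  have i3 := gK_int (ν + 1) (by linarith) k
  rw [← integral_const_mul, ← integral_const_mul, ← integral_sub i1 i2]
  have i12 : Integrable (fun t => (ν + k + 1) * gK ν k t - (k + 1) * gK ν (k + 1) t)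
    (volume.restrict (Set.Ioi 0)) := i1.sub i2
  rw [← integral_sub i12 i3]
  have key := integral_Ioi_of_hasDerivAt_of_tendsto (a := 0) (m := 0) (f := gK (ν + 1) k)
    (f' := fun t => (ν + k + 1) * gK ν k t - (k + 1) * gK ν (k + 1) t - gK (ν + 1) k t)
    ?_ ?_ ((i1.sub i2).sub i3) ?_
  · rw [key]
    unfold gK
    rw [Real.zero_rpow (by linarith)]
    simp
  · apply ContinuousAt.continuousWithinAt
    unfold gK
    refine ContinuousAt.mul (ContinuousAt.mul ?_ ?_) (by fun_prop)
    · exact Real.continuousAt_rpow_const _ _ (Or.inr (by linarith))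
    · exact ContinuousAt.inv₀ (by fun_prop) (by simp)
  · intro t ht
    have ht : 0 < t := ht
    have d1 := Real.hasDerivAt_rpow_const (x := t) (p := ν + 1 + k) (Or.inl ht.ne')
    have d2 : HasDerivAt (fun t : ℝ => ((1 + t) ^ (k + 1))⁻¹)
        (-((k + 1) * (1 + t) ^ k) / ((1 + t) ^ (k + 1)) ^ 2) t := by
      have d0 : HasDerivAt (fun t : ℝ => (1 + t) ^ (k + 1)) ((k + 1) * (1 + t) ^ k) t := by
        simpa using ((hasDerivAt_id' t).const_add 1).fun_pow (k + 1)
      exact d0.fun_inv (by positivity)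
    have d3 : HasDerivAt (fun t : ℝ => Real.exp (-t)) (-Real.exp (-t)) t := by
      simpa using (hasDerivAt_neg t).exp
    have d := (d1.mul d2).mul d3
    refine d.congr_deriv ?_
    unfold gK
    have e1 : t ^ (ν + 1 + k) = t ^ (ν + k) * t := by
      rw [← Real.rpow_add_one ht.ne']; congr 1; ring
    have e2 : t ^ (ν + (k + 1 : ℕ)) = t ^ (ν + k) * t := by
      rw [← Real.rpow_add_one ht.ne']; congr 1; push_cast; ring
    have e3 : ν + 1 + k - 1 = ν + k := by ring
    have h1 : (1 + t) ≠ 0 := by positivity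
    simp only [Pi.mul_apply, e1, e2, e3]
    field_simp
    ring
  · have h := tendsto_rpow_mul_exp_neg_mul_atTop_nhds_zero (ν + 1 + k) 1 one_pos
    refine squeeze_zero' ?_ ?_ h
    · filter_upwards [Filter.eventually_gt_atTop 0] with t ht
      unfold gK
      positivity
    · filter_upwards [Filter.eventually_gt_atTop 0] with t ht
      unfold gK
      have h1 : ((1 + t) ^ (k + 1))⁻¹ ≤ 1 := inv_le_one_of_one_le₀ (one_le_pow₀ (by linarith))
      have h2 : 0 ≤ t ^ (ν + 1 + k) * Real.exp (-t) := by positivity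
      rw [neg_one_mul]
      nlinarith

noncomputable def FK (ν : ℝ) (k : ℕ) (x t : ℝ) : ℝ :=
  x ^ k * Real.exp (-x) * (t ^ (ν - 1) * Real.exp (-t - x / t))

lemma FK_eq (ν : ℝ) (k : ℕ) (x t : ℝ) :
    FK ν k x t = t ^ (ν - 1) * Real.exp (-t) * (x ^ ((k + 1 : ℝ) - 1) * Real.exp (-((1 + 1 / t) * x))) := by
  have : Real.exp (-x) * Real.exp (-t - x / t) = Real.exp (-t) * Real.exp (-((1 + 1 / t) * x)) := by
    rw [← Real.exp_add, ← Real.exp_add]; congr 1; ring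
  unfold FK
  rw [show (k + 1 : ℝ) - 1 = k by ring, Real.rpow_natCast]
  linear_combination x ^ k * t ^ (ν - 1) * this

lemma FK_int_x (ν : ℝ) (k : ℕ) (t : ℝ) (ht : 0 < t) :
    IntegrableOn (fun x => FK ν k x t) (Set.Ioi 0) := by
  have hk : (0 : ℝ) ≤ k := Nat.cast_nonneg k
  have h := integrableOn_rpow_mul_exp_neg_mul_rpow (s := (k + 1 : ℝ) - 1) (p := 1)
    (b := 1 + 1 / t) (by linarith) one_pos (by positivity)
  simp only [FK_eq]
  refine Integrable.const_mul ?_ _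
  refine Integrable.congr h (Filter.Eventually.of_forall fun x => ?_)
  simp only [Real.rpow_one, neg_mul]

lemma FK_integral_x (ν : ℝ) (k : ℕ) (t : ℝ) (ht : 0 < t) :
    ∫ x in Set.Ioi (0 : ℝ), FK ν k x t = k.factorial * gK ν k t := by
  have hk : (0 : ℝ) ≤ k := Nat.cast_nonneg k
  simp only [FK_eq]
  rw [integral_const_mul, Real.integral_rpow_mul_exp_neg_mul_Ioi (by linarith) (by positivity),
    Real.Gamma_nat_eq_factorial]
  have e1 : (1 / (1 + 1 / t)) ^ ((k : ℝ) + 1) = t ^ (k + 1) * ((1 + t) ^ (k + 1))⁻¹ := by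
    rw [← Nat.cast_add_one, Real.rpow_natCast, ← inv_pow, ← mul_pow]
    congr 1
    field_simp
    ring
  have e2 : t ^ (ν + k) = t ^ (ν - 1) * t ^ (k + 1) := by
    rw [← Real.rpow_natCast, ← Real.rpow_add ht]; congr 1; push_cast; ring
  rw [e1]
  unfold gK
  rw [e2]
  ring

lemma FK_int (ν : ℝ) (hν : ν > -1) (k : ℕ) :
    Integrable (Function.uncurry (FK ν k))
      ((volume.restrict (Set.Ioi 0)).prod (volume.restrict (Set.Ioi 0))) := by
  rw [integrable_prod_iff']
  · constructor
    · filter_upwards [ae_restrict_mem measurableSet_Ioi] with t ht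
      exact FK_int_x ν k t ht
    · refine ((gK_int ν hν k).const_mul (k.factorial : ℝ)).congr ?_
      filter_upwards [ae_restrict_mem measurableSet_Ioi] with t ht
      have ht : 0 < t := ht
      rw [← FK_integral_x ν k t ht]
      refine setIntegral_congr_fun measurableSet_Ioi fun x hx => ?_
      have hx : 0 < x := hx
      simp only [Function.uncurry]
      rw [Real.norm_of_nonneg]
      unfold FK
      positivity
  · unfold FK Function.uncurry
    apply Measurable.aestronglyMeasurable
    exact Measurable.mul (by fun_prop) (Measurable.mul (by fun_prop) (by fun_prop))

lemma FK_rho (ν : ℝ) (k : ℕ) (x : ℝ) :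
    ∫ t in Set.Ioi (0 : ℝ), FK ν k x t = x ^ k * Real.exp (-x) * rho ν x := by
  unfold FK rho
  rw [integral_const_mul]

lemma mom_int (ν : ℝ) (hν : ν > -1) (k : ℕ) :
    IntegrableOn (fun x => x ^ k * Real.exp (-x) * rho ν x) (Set.Ioi 0) := by
  have := (FK_int ν hν k).integral_prod_left
  simp only [Function.uncurry, FK_rho] at this
  exact this

lemma mom_eq (ν : ℝ) (hν : ν > -1) (k : ℕ) :
    ∫ x in Set.Ioi (0 : ℝ), x ^ k * Real.exp (-x) * rho ν x
      = k.factorial * ∫ t in Set.Ioi (0 : ℝ), gK ν k t := by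
  simp only [← FK_rho]
  rw [integral_integral_swap (FK_int ν hν k), ← integral_const_mul]
  exact setIntegral_congr_fun measurableSet_Ioi fun t ht => FK_integral_x ν k t ht

lemma poly_int (ν : ℝ) (hν : ν > -1) (Q : Polynomial ℝ) :
    IntegrableOn (fun x => Q.eval x * Real.exp (-x) * rho ν x) (Set.Ioi 0) := by
  induction Q using Polynomial.induction_on' with
  | add p q hp hq =>
    refine (Integrable.add hp hq).congr (Filter.Eventually.of_forall fun x => ?_)
    simp; ring
  | monomial n a =>
    refine ((mom_int ν hν n).const_mul a).congr (Filter.Eventually.of_forall fun x => ?_)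
    simp; ring

/-- The moment functional. -/
noncomputable def LK (ν : ℝ) (hν : ν > -1) : Polynomial ℝ →ₗ[ℝ] ℝ where
  toFun Q := ∫ x in Set.Ioi (0 : ℝ), Q.eval x * Real.exp (-x) * rho ν x
  map_add' p q := by
    rw [← integral_add (poly_int ν hν p) (poly_int ν hν q)]
    congr 1; ext x; simp; ring
  map_smul' c p := by
    simp only [RingHom.id_apply, smul_eq_mul]
    rw [← integral_const_mul]
    congr 1; ext x; simp; ring

lemma LK_apply (ν : ℝ) (hν : ν > -1) (Q : Polynomial ℝ) :
    LK ν hν Q = ∫ x in Set.Ioi (0 : ℝ), Q.eval x * Real.exp (-x) * rho ν x := rfl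

lemma LK_mon (ν : ℝ) (hν : ν > -1) (n : ℕ) (a : ℝ) :
    LK ν hν (Polynomial.monomial n a)
      = a * (n.factorial * ∫ t in Set.Ioi (0 : ℝ), gK ν n t) := by
  rw [← mom_eq ν hν, ← integral_const_mul, LK_apply]
  congr 1; ext x; simp; ring

lemma LK_rec (ν : ℝ) (hν : ν > -1) (hν' : ν + 1 > -1) (Q : Polynomial ℝ) :
    LK (ν + 1) hν' Q = (1 + ν) * LK ν hν Q - LK ν hν (Polynomial.X * Q)
      + LK ν hν (Polynomial.X * Polynomial.derivative Q) := by
  induction Q using Polynomial.induction_on' with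
  | add p q hp hq =>
    simp only [mul_add, map_add, hp, hq]; ring
  | monomial n a =>
    have e : Polynomial.X * Polynomial.derivative (Polynomial.monomial n a)
        = Polynomial.monomial n (a * n) := by
      rw [Polynomial.derivative_monomial, Polynomial.X_mul_monomial]
      cases n <;> simp
    rw [e, Polynomial.X_mul_monomial]
    simp only [LK_mon, Nat.factorial_succ]
    have := gK_rec ν hν n
    push_cast
    linear_combination (-a * n.factorial) * this

theorem value_V (ν : ℝ) (hν : ν > -1) (P : ℕ → Polynomial ℝ)
    (hdeg : ∀ n, (P n).degree = n)
    (horth : ∀ m n, ∫ x in Set.Ioi (0 : ℝ),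
      (P m).eval x * (P n).eval x * Real.exp (-x) * rho ν x =
        if m = n then (1 : ℝ) else 0)
    (B : ℕ → ℝ)
    (hB : ∀ n, B n = ∫ x in Set.Ioi (0 : ℝ),
      x * ((P n).eval x) ^ 2 * Real.exp (-x) * rho ν x) :
    ∀ n, ∫ x in Set.Ioi (0 : ℝ),
        ((P n).eval x) ^ 2 * Real.exp (-x) * rho (ν + 1) x =
      ν + 2 * n + 1 - B n := by
  intro n
  have hν' : ν + 1 > -1 := by linarith
  have ho : ∀ m n, LK ν hν (P m * P n) = if m = n then (1 : ℝ) else 0 := by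
    intro m n
    rw [← horth m n, LK_apply]
    simp
  have hBn : B n = LK ν hν (Polynomial.X * P n ^ 2) := by
    rw [hB, LK_apply]; simp
  have hL : ∫ x in Set.Ioi (0 : ℝ), ((P n).eval x) ^ 2 * Real.exp (-x) * rho (ν + 1) x
      = LK (ν + 1) hν' (P n ^ 2) := by
    rw [LK_apply]; simp
  have hlow : ∀ m ≤ n, ∀ Q : Polynomial ℝ, Q.degree < m → LK ν hν (P n * Q) = 0 := by
    intro m
    induction m with
    | zero =>
      intro _ Q hQ
      have : Q = 0 := by
        rw [← Polynomial.degree_eq_bot]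
        simpa using hQ
      simp [this]
    | succ m ih =>
      intro hm Q hQ
      have hlc : (P m).coeff m ≠ 0 := Polynomial.coeff_ne_zero_of_eq_degree (hdeg m)
      set c := Q.coeff m / (P m).coeff m with hc
      have h1 : (Q - Polynomial.C c * P m).degree < m := by
        rw [Polynomial.degree_lt_iff_coeff_zero] at hQ ⊢
        intro j hj
        rcases hj.eq_or_lt with rfl | hj
        · simp [hc, hlc]
        · have : (P m).coeff j = 0 := Polynomial.coeff_eq_zero_of_degree_lt (by
            rw [hdeg]; exact_mod_cast hj)
          simp [this, hQ j hj]
      have h2 := ih (by omega) _ h1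
      have h3 : P n * Q = P n * (Q - Polynomial.C c * P m) + c • (P n * P m) := by
        rw [Polynomial.smul_eq_C_mul]; ring
      rw [h3, map_add, h2, map_smul, ho, if_neg (by omega)]
      simp
  have hd : (Polynomial.X * Polynomial.derivative (P n) - Polynomial.C (n : ℝ) * P n).degree < (n : WithBot ℕ) := by
    rw [Polynomial.degree_lt_iff_coeff_zero]
    intro j hj
    have hx : (Polynomial.X * Polynomial.derivative (P n)).coeff j = j * (P n).coeff j := by
      cases j with
      | zero => simp
      | succ j => rw [Polynomial.coeff_X_mul, Polynomial.coeff_derivative]; push_cast; ring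
    rw [Polynomial.coeff_sub, hx, Polynomial.coeff_C_mul]
    rcases hj.eq_or_lt with rfl | hj
    · ring
    · have : (P n).coeff j = 0 := Polynomial.coeff_eq_zero_of_degree_lt (by
        rw [hdeg]; exact_mod_cast hj)
      simp [this]
  have h0 := hlow n le_rfl _ hd
  have h4 : Polynomial.X * Polynomial.derivative (P n ^ 2)
      = (2 : ℝ) • (P n * (Polynomial.X * Polynomial.derivative (P n) - Polynomial.C (n : ℝ) * P n))
        + (2 * n : ℝ) • (P n * P n) := by
    simp only [Polynomial.smul_eq_C_mul, Polynomial.derivative_pow, Polynomial.C_mul]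
    simp
    ring
  have h5 : LK ν hν (P n ^ 2) = 1 := by rw [pow_two, ho]; simp
  rw [hL, LK_rec ν hν hν', ← hBn, h4, map_add, map_smul, map_smul, h0, ho, h5]
  simp
  ring
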